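/- Let n ≥ 2 and let P=(a,a') and Q=(b,b') be points of F₀(ℝⁿ,2) with 0 < δ ≤ 2, ‖h‖ > 1 and ‖k‖ > 1. Then h and k are linearly independent; let (u,v) be the unique pair of unit vectors with h·u = 1, k·v = 1 and minimal ‖u−v‖, and let β ∈ [0,π) be the angle between u and v (cos β = u·v). Then the infimum of the lengths of continuous paths in F₀(ℝⁿ,2) from P to Q equals √(2(‖A−B‖² + (β+S₀+S₁)²)), and this infimum is attained (by the geodesic ℓ₁σℓ₂ composed of a linear segment, a boundary geodesic, and a linear segment). -/

import Mathlib

open scoped RealInnerProductSpace ENNReal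

/-- The pair `(x, y) ∈ ℝⁿ × ℝⁿ` viewed in `ℝ²ⁿ` with the Euclidean (`L²`) metric. -/
noncomputable def toL2 {n : ℕ} (x y : EuclideanSpace ℝ (Fin n)) :
    WithLp 2 (EuclideanSpace ℝ (Fin n) × EuclideanSpace ℝ (Fin n)) :=
  (WithLp.equiv 2 (EuclideanSpace ℝ (Fin n) × EuclideanSpace ℝ (Fin n))).symm (x, y)

/-- `F₀(ℝⁿ,2) = {(x,xp) : ‖x - xp‖ ≥ 2}` as a subset of `ℝ²ⁿ` with the Euclidean metric. -/
def F0 (n : ℕ) : Set (WithLp 2 (EuclideanSpace ℝ (Fin n) × EuclideanSpace ℝ (Fin n))) :=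
  {p | 2 ≤ ‖(WithLp.equiv 2 (EuclideanSpace ℝ (Fin n) × EuclideanSpace ℝ (Fin n)) p).1 -
        (WithLp.equiv 2 (EuclideanSpace ℝ (Fin n) × EuclideanSpace ℝ (Fin n)) p).2‖}

section PathLength

open Set Filter Topology InnerProductGeometry

/-- The length of a path dominates the displacement of any function of the parameter that is
nonexpanding with respect to the path at small scales. -/
theorem edist_le_eVariationOn_of_dist_le {W V : Type*} [PseudoMetricSpace W]
    [PseudoMetricSpace V] {f : ℝ → W} {φ : ℝ → V} {a b ε : ℝ} (hab : a ≤ b)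
    (hf : ContinuousOn f (Icc a b)) (hε : 0 < ε)
    (h : ∀ s ∈ Icc a b, ∀ t ∈ Icc a b, dist (f s) (f t) < ε →
      dist (φ s) (φ t) ≤ dist (f s) (f t)) :
    edist (φ a) (φ b) ≤ eVariationOn f (Icc a b) := by
  obtain ⟨δ, hδ, hfδ⟩ := Metric.uniformContinuousOn_iff.1
    (isCompact_Icc.uniformContinuousOn_of_continuous hf) ε hε
  obtain ⟨N, hN⟩ := exists_nat_gt ((b - a) / δ)
  have hN0 : (0 : ℝ) < N := lt_of_le_of_lt (div_nonneg (by linarith) hδ.le) hN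
  set w : ℝ := (b - a) / N with hw
  have hw0 : 0 ≤ w := div_nonneg (by linarith) hN0.le
  have hNw : N * w = b - a := by rw [hw]; field_simp
  have hwδ : w < δ := by
    rw [hw, div_lt_iff₀ hN0]
    rwa [div_lt_iff₀ hδ, mul_comm] at hN
  have key : ∀ i : ℕ, i ≤ N →
      edist (φ a) (φ (a + i * w)) ≤ eVariationOn f (Icc a (a + i * w)) := by
    intro i
    induction i with
    | zero => intro _; simp
    | succ i ih =>
      intro hi
      have hiN : ((i : ℝ) + 1) * w ≤ N * w :=
        mul_le_mul_of_nonneg_right (by exact_mod_cast hi) hw0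
      have hi0 : 0 ≤ (i : ℝ) * w := by positivity
      have e : a + ((i + 1 : ℕ) : ℝ) * w = a + i * w + w := by push_cast; ring
      have h1 : a + i * w ∈ Icc a b := ⟨by linarith, by linarith⟩
      have h2 : a + i * w + w ∈ Icc a b := ⟨by linarith, by linarith⟩
      have hsmall : dist (f (a + i * w)) (f (a + i * w + w)) < ε := by
        apply hfδ _ h1 _ h2
        rw [Real.dist_eq, abs_sub_comm, add_sub_cancel_left, abs_of_nonneg hw0]
        exact hwδ
      have hstep : edist (φ (a + i * w)) (φ (a + i * w + w)) ≤
          eVariationOn f (Icc (a + i * w) (a + i * w + w)) := by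
        refine le_trans ?_ (eVariationOn.edist_le f (left_mem_Icc.2 (by linarith))
          (right_mem_Icc.2 (by linarith)))
        rw [edist_dist, edist_dist]
        exact ENNReal.ofReal_le_ofReal (h _ h1 _ h2 hsmall)
      have hadd := eVariationOn.Icc_add_Icc f (s := univ) h1.1
        (show a + i * w ≤ a + i * w + w by linarith) (mem_univ _)
      simp only [univ_inter] at hadd
      rw [e, ← hadd]
      exact (edist_triangle _ _ _).trans (add_le_add (ih (by omega)) hstep)
  have := key N le_rfl
  rwa [hNw, add_sub_cancel] at this

theorem cos_mul_sub_le_sin_sub_sin {x y : ℝ} (hx0 : 0 ≤ x) (hx : x ≤ Real.pi / 2) (hxy : -x ≤ y)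
    (hy : y ≤ Real.pi / 2) : Real.cos x * (x - y) ≤ Real.sin x - Real.sin y := by
  have hpi := Real.pi_pos
  have mvt : ∀ p q : ℝ, p < q → ∃ c ∈ Ioo p q, Real.sin q - Real.sin p = Real.cos c * (q - p) := by
    intro p q hpq
    obtain ⟨c, hc, h⟩ := exists_deriv_eq_slope Real.sin hpq Real.continuous_sin.continuousOn
      Real.differentiable_sin.differentiableOn
    refine ⟨c, hc, ?_⟩
    rw [Real.deriv_sin, eq_div_iff (by linarith)] at h
    exact h.symm
  rcases lt_trichotomy x y with h | h | h
  · obtain ⟨c, hc, e⟩ := mvt x y h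
    have := Real.cos_le_cos_of_nonneg_of_le_pi hx0
      (by linarith [hc.2] : c ≤ Real.pi) hc.1.le
    nlinarith
  · subst h; simp
  · obtain ⟨c, hc, e⟩ := mvt y x h
    have : Real.cos x ≤ Real.cos c := by
      rw [← Real.cos_abs c]
      exact Real.cos_le_cos_of_nonneg_of_le_pi (abs_nonneg c) (by linarith)
        (abs_le.2 ⟨by linarith [hc.1], hc.2.le⟩)
    rw [e]
    exact mul_le_mul_of_nonneg_right this (by linarith)

section Wave

variable {E : Type*} [NormedAddCommGroup E] [InnerProductSpace ℝ E]

theorem norm_mul_sin_sub_le_norm_sub (x y : E) (t : ℝ) :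
    ‖y‖ * Real.sin t - ‖x‖ * Real.sin (t - angle x y) ≤ ‖y - x‖ := by
  have hlaw := norm_sub_sq_eq_norm_sq_add_norm_sq_sub_two_mul_norm_mul_norm_mul_cos_angle y x
  rw [angle_comm] at hlaw
  set c := t - angle x y with hc
  have hcos : Real.cos (angle x y) = Real.cos t * Real.cos c + Real.sin t * Real.sin c := by
    rw [← Real.cos_sub]; congr 1; rw [hc]; ring
  rw [hcos] at hlaw
  apply le_of_sq_le_sq _ (norm_nonneg _)
  nlinarith [sq_nonneg (‖y‖ * Real.cos t - ‖x‖ * Real.cos c), Real.sin_sq_add_cos_sq t,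
    Real.sin_sq_add_cos_sq c]

/-- The wavefront function of the ball of radius `ρ`: up to a constant, the length of a taut
string from the axis of `h` that wraps around the ball before running tangentially to `x`. -/
noncomputable def wave (ρ : ℝ) (h x : E) : ℝ :=
  ρ * (angle h x - Real.arccos (ρ / ‖x‖)) + ‖x‖ * Real.sin (Real.arccos (ρ / ‖x‖))

theorem continuous_wave (h x : E) : Continuous fun ρ : ℝ => wave ρ h x := by
  unfold wave
  have := Real.continuous_arccos
  fun_prop

theorem wave_sub_le {ρ : ℝ} (hρ : 0 < ρ) (hρ1 : ρ ≤ 1) (h : E) {x y : E} (hx : 1 ≤ ‖x‖)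
    (hy : 1 ≤ ‖y‖) (hxy : ‖x - y‖ ^ 2 ≤ 4 * (1 - ρ ^ 2)) :
    wave ρ h y - wave ρ h x ≤ ‖x - y‖ := by
  have hdiv : ∀ z : E, 1 ≤ ‖z‖ → 0 ≤ ρ / ‖z‖ ∧ ρ / ‖z‖ ≤ ρ := fun z hz =>
    ⟨by positivity, div_le_self hρ.le hz⟩
  have hω : angle x y ≤ 2 * Real.arccos ρ := by
    have hlaw := norm_sub_sq_eq_norm_sq_add_norm_sq_sub_two_mul_norm_mul_norm_mul_cos_angle x y
    have h0 : 0 ≤ 2 * Real.arccos ρ := by linarith [Real.arccos_nonneg ρ]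
    have hle : 2 * Real.arccos ρ ≤ Real.pi := by
      linarith [Real.arccos_le_pi_div_two.2 hρ.le]
    rw [← Real.arccos_cos h0 hle, ← Real.arccos_cos (angle_nonneg x y) (angle_le_pi x y)]
    apply Real.arccos_le_arccos
    rw [Real.cos_two_mul, Real.cos_arccos (by linarith) hρ1]
    have h1 : 1 ≤ ‖x‖ * ‖y‖ := by nlinarith
    nlinarith [sq_nonneg (‖x‖ - ‖y‖), Real.cos_le_one (angle x y)]
  have hax := Real.arccos_le_arccos (hdiv x hx).2
  have hay := Real.arccos_le_arccos (hdiv y hy).2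
  have hcosx : ‖x‖ * Real.cos (Real.arccos (ρ / ‖x‖)) = ρ := by
    rw [Real.cos_arccos (by linarith [(hdiv x hx).1]) (by linarith [(hdiv x hx).2])]
    field_simp
  have hay2 := Real.arccos_le_pi_div_two.2 (hdiv y hy).1
  have hax2 := Real.arccos_le_pi_div_two.2 (hdiv x hx).1
  have htri := angle_le_angle_add_angle h x y
  have hchord := norm_mul_sin_sub_le_norm_sub x y (Real.arccos (ρ / ‖y‖))
  rw [norm_sub_rev] at hchord
  have hsin := mul_le_mul_of_nonneg_left (cos_mul_sub_le_sin_sub_sin (Real.arccos_nonneg _) hax2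
    (y := Real.arccos (ρ / ‖y‖) - angle x y) (by linarith)
    (by linarith [angle_nonneg x y])) (norm_nonneg x)
  rw [← mul_assoc, hcosx] at hsin
  unfold wave
  nlinarith

theorem abs_wave_sub_le {ρ : ℝ} (hρ : 0 < ρ) (hρ1 : ρ ≤ 1) (h : E) {x y : E} (hx : 1 ≤ ‖x‖)
    (hy : 1 ≤ ‖y‖) (hxy : ‖x - y‖ ^ 2 ≤ 4 * (1 - ρ ^ 2)) :
    |wave ρ h x - wave ρ h y| ≤ ‖x - y‖ := by
  rw [abs_le]
  have h1 := wave_sub_le hρ hρ1 h hx hy hxy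
  have h2 := wave_sub_le hρ hρ1 h hy hx (by rwa [norm_sub_rev])
  rw [norm_sub_rev] at h2
  constructor <;> linarith

/-- The midpoint of a pair of points. -/
noncomputable def pairMid (p : WithLp 2 (E × E)) : E := (2 : ℝ)⁻¹ • (p.fst + p.snd)

/-- Half the difference of a pair of points. -/
noncomputable def pairHalf (p : WithLp 2 (E × E)) : E := (2 : ℝ)⁻¹ • (p.snd - p.fst)

theorem continuous_pairMid : Continuous (pairMid (E := E)) := by
  unfold pairMid; fun_prop

theorem continuous_pairHalf : Continuous (pairHalf (E := E)) := by
  unfold pairHalf; fun_prop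

theorem dist_sq_eq_pairMid_pairHalf (p p' : WithLp 2 (E × E)) :
    dist p p' ^ 2 =
      2 * (‖pairMid p - pairMid p'‖ ^ 2 + ‖pairHalf p - pairHalf p'‖ ^ 2) := by
  have e1 : pairMid p - pairMid p' =
      (2 : ℝ)⁻¹ • ((p.fst - p'.fst) + (p.snd - p'.snd)) := by
    unfold pairMid; module
  have e2 : pairHalf p - pairHalf p' =
      (2 : ℝ)⁻¹ • ((p.snd - p'.snd) - (p.fst - p'.fst)) := by
    unfold pairHalf; module
  have hpar := parallelogram_law_with_norm ℝ (p.snd - p'.snd) (p.fst - p'.fst)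
  rw [add_comm (p.snd - p'.snd)] at hpar
  rw [dist_eq_norm, WithLp.prod_norm_sq_eq_of_L2, WithLp.sub_fst, WithLp.sub_snd, e1, e2,
    norm_smul, norm_smul, Real.norm_of_nonneg (by norm_num : (0 : ℝ) ≤ 2⁻¹)]
  linear_combination -(1 / 2 : ℝ) * hpar

theorem norm_toLp_sqrt_two_sq (x : E) (r : ℝ) :
    ‖WithLp.toLp 2 (√2 • x, √2 * r)‖ ^ 2 = 2 * (‖x‖ ^ 2 + r ^ 2) := by
  rw [WithLp.prod_norm_sq_eq_of_L2]
  change ‖√2 • x‖ ^ 2 + ‖√2 * r‖ ^ 2 = _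
  rw [norm_smul, norm_mul, mul_pow, mul_pow, Real.norm_eq_abs, sq_abs,
    Real.sq_sqrt zero_le_two, Real.norm_eq_abs, sq_abs]
  ring

theorem norm_eq_of_angle_eq {h x : E} (hh : 1 ≤ ‖h‖) (hx : 1 ≤ ‖x‖)
    (hang : angle h x = Real.arccos (1 / ‖h‖) + Real.arccos (1 / ‖x‖)) :
    ‖h - x‖ = ‖h‖ * Real.sin (Real.arccos (1 / ‖h‖)) +
      ‖x‖ * Real.sin (Real.arccos (1 / ‖x‖)) := by
  have hcos : ∀ z : E, 1 ≤ ‖z‖ → ‖z‖ * Real.cos (Real.arccos (1 / ‖z‖)) = 1 := fun z hz => by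
    have h0 : 0 ≤ 1 / ‖z‖ := by positivity
    rw [Real.cos_arccos (by linarith) (div_le_self zero_le_one hz)]
    field_simp
  have hsin : ∀ z : E, 0 ≤ ‖z‖ * Real.sin (Real.arccos (1 / ‖z‖)) := fun z =>
    mul_nonneg (norm_nonneg z)
      (Real.sin_nonneg_of_nonneg_of_le_pi (Real.arccos_nonneg _) (Real.arccos_le_pi _))
  have hlaw := norm_sub_sq_eq_norm_sq_add_norm_sq_sub_two_mul_norm_mul_norm_mul_cos_angle h x
  rw [hang, Real.cos_add] at hlaw
  have c1 := hcos h hh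
  have c2 := hcos x hx
  have s1 := hsin h
  have s2 := hsin x
  have t1 := Real.sin_sq_add_cos_sq (Real.arccos (1 / ‖h‖))
  have t2 := Real.sin_sq_add_cos_sq (Real.arccos (1 / ‖x‖))
  generalize Real.sin (Real.arccos (1 / ‖h‖)) = sh at *
  generalize Real.sin (Real.arccos (1 / ‖x‖)) = sx at *
  generalize Real.cos (Real.arccos (1 / ‖h‖)) = ch at *
  generalize Real.cos (Real.arccos (1 / ‖x‖)) = cx at *
  rw [← sq_eq_sq₀ (norm_nonneg _) (by linarith)]
  have r1 : ‖h‖ ^ 2 = 1 + (‖h‖ * sh) ^ 2 := by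
    calc ‖h‖ ^ 2 = (‖h‖ * ch) ^ 2 + (‖h‖ * sh) ^ 2 := by linear_combination -‖h‖ ^ 2 * t1
      _ = _ := by rw [c1]; ring
  have r2 : ‖x‖ ^ 2 = 1 + (‖x‖ * sx) ^ 2 := by
    calc ‖x‖ ^ 2 = (‖x‖ * cx) ^ 2 + (‖x‖ * sx) ^ 2 := by linear_combination -‖x‖ ^ 2 * t2
      _ = _ := by rw [c2]; ring
  have hprod : ‖h‖ * ch * (‖x‖ * cx) = 1 := by rw [c1, c2, one_mul]
  linear_combination hlaw + r1 + r2 - 2 * hprod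

/-- Lower bound for the length of a path of pairs at distance at least `2` from each other. -/
theorem ofReal_sqrt_le_eVariationOn {γ : ℝ → WithLp 2 (E × E)}
    (hγ : ContinuousOn γ (Icc 0 1)) (hout : ∀ t ∈ Icc (0 : ℝ) 1, 1 ≤ ‖pairHalf (γ t)‖)
    {h k : E} (hh : pairHalf (γ 0) = h) (hk : pairHalf (γ 1) = k)
    (hang : Real.arccos (1 / ‖h‖) + Real.arccos (1 / ‖k‖) ≤ angle h k) :
    ENNReal.ofReal (√(2 * (‖pairMid (γ 0) - pairMid (γ 1)‖ ^ 2 +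
      (angle h k - Real.arccos (1 / ‖h‖) - Real.arccos (1 / ‖k‖) +
        ‖h‖ * Real.sin (Real.arccos (1 / ‖h‖)) +
        ‖k‖ * Real.sin (Real.arccos (1 / ‖k‖))) ^ 2))) ≤ eVariationOn γ (Icc 0 1) := by
  have h0 : (0 : ℝ) ∈ Icc (0 : ℝ) 1 := ⟨le_rfl, zero_le_one⟩
  have h1 : (1 : ℝ) ∈ Icc (0 : ℝ) 1 := ⟨zero_le_one, le_rfl⟩
  have hh1 : 1 ≤ ‖h‖ := hh ▸ hout 0 h0
  have hne : ∀ x : E, 1 ≤ ‖x‖ → x ≠ 0 := fun x hx => norm_pos_iff.1 (by linarith)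
  have hq : ContinuousOn (fun t => pairHalf (γ t)) (Icc 0 1) :=
    continuous_pairHalf.comp_continuousOn hγ
  have hGc : ContinuousOn (fun t => angle h (pairHalf (γ t)) -
      Real.arccos (1 / ‖pairHalf (γ t)‖)) (Icc 0 1) := by
    apply ContinuousOn.sub
    · intro t ht
      exact (continuousAt_angle (x := (h, pairHalf (γ t))) (hne h hh1)
        (hne _ (hout t ht))).comp_continuousWithinAt
          (f := fun s => (h, pairHalf (γ s))) (continuousWithinAt_const.prodMk (hq t ht))
    · exact Real.continuous_arccos.comp_continuousOn
        (continuousOn_const.div hq.norm fun t ht => by linarith [hout t ht])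
  obtain ⟨t₀, ht₀, hG⟩ : Real.arccos (1 / ‖h‖) ∈ (fun t => angle h (pairHalf (γ t)) -
      Real.arccos (1 / ‖pairHalf (γ t)‖)) '' Icc 0 1 := by
    apply intermediate_value_Icc zero_le_one hGc
    constructor
    · simp only [hh, angle_self (hne h hh1)]
      linarith [Real.arccos_nonneg (1 / ‖h‖)]
    · simp only [hk]; linarith
  simp only at hG
  set x := pairHalf (γ t₀) with hx
  have hdist : ‖h - x‖ = _ := norm_eq_of_angle_eq hh1 (hout t₀ ht₀) (by linarith)
  let Φ : ℝ → ℝ → WithLp 2 (E × ℝ) := fun ρ t =>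
    WithLp.toLp 2 (√2 • pairMid (γ t), √2 * wave ρ h (pairHalf (γ t)))
  have hΦ : ∀ ρ s t, dist (Φ ρ s) (Φ ρ t) ^ 2 = 2 * (‖pairMid (γ s) - pairMid (γ t)‖ ^ 2 +
      (wave ρ h (pairHalf (γ s)) - wave ρ h (pairHalf (γ t))) ^ 2) := by
    intro ρ s t
    rw [dist_eq_norm, ← WithLp.toLp_sub, Prod.mk_sub_mk, ← smul_sub, ← mul_sub,
      norm_toLp_sqrt_two_sq]
  have hfar : edist (Φ 1 t₀) (Φ 1 1) ≤ eVariationOn γ (Icc t₀ 1) := by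
    have hcont : Continuous fun ρ => edist (Φ ρ t₀) (Φ ρ 1) := by
      have := continuous_wave h (pairHalf (γ t₀))
      have := continuous_wave h (pairHalf (γ 1))
      simp only [Φ]
      fun_prop
    refine le_of_tendsto ((hcont.tendsto 1).mono_left (nhdsWithin_le_nhds (s := Iio 1))) ?_
    filter_upwards [Ioo_mem_nhdsLT (show (0 : ℝ) < 1 by norm_num)] with ρ hρ
    have hpos : 0 < 4 * (1 - ρ ^ 2) := by nlinarith [hρ.1, hρ.2]
    have hsub : ∀ s ∈ Icc t₀ 1, s ∈ Icc (0 : ℝ) 1 := fun s hs => ⟨ht₀.1.trans hs.1, hs.2⟩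
    refine edist_le_eVariationOn_of_dist_le (φ := Φ ρ) ht₀.2 (hγ.mono hsub)
      (Real.sqrt_pos.2 hpos) fun s hs t ht hst => ?_
    rw [← sq_le_sq₀ dist_nonneg dist_nonneg, hΦ, dist_sq_eq_pairMid_pairHalf]
    have hst2 : dist (γ s) (γ t) ^ 2 < 4 * (1 - ρ ^ 2) := (Real.lt_sqrt dist_nonneg).1 hst
    rw [dist_sq_eq_pairMid_pairHalf] at hst2
    have hw := abs_wave_sub_le hρ.1 hρ.2.le h (hout s (hsub s hs)) (hout t (hsub t ht))
      (by nlinarith [sq_nonneg ‖pairMid (γ s) - pairMid (γ t)‖,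
        sq_nonneg ‖pairHalf (γ s) - pairHalf (γ t)‖])
    have := sq_le_sq' (by linarith [neg_abs_le (wave ρ h (pairHalf (γ s)) -
      wave ρ h (pairHalf (γ t)))]) ((le_abs_self _).trans hw)
    linarith
  have hnear : edist (γ 0) (γ t₀) ≤ eVariationOn γ (Icc 0 t₀) :=
    eVariationOn.edist_le γ (left_mem_Icc.2 ht₀.1) (right_mem_Icc.2 ht₀.1)
  have hadd := eVariationOn.Icc_add_Icc γ (s := univ) ht₀.1 ht₀.2 (mem_univ _)
  simp only [univ_inter] at hadd
  rw [← hadd]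
  refine le_trans ?_ (add_le_add hnear hfar)
  let X : WithLp 2 (E × ℝ) := WithLp.toLp 2 (√2 • (pairMid (γ 0) - pairMid (γ t₀)),
    √2 * -‖h - x‖)
  have hX : dist (γ 0) (γ t₀) = ‖X‖ := by
    rw [← sq_eq_sq₀ dist_nonneg (norm_nonneg _), dist_sq_eq_pairMid_pairHalf,
      norm_toLp_sqrt_two_sq, hh, neg_sq]
  rw [edist_dist, edist_dist, ← ENNReal.ofReal_add dist_nonneg dist_nonneg]
  apply ENNReal.ofReal_le_ofReal
  rw [hX, dist_eq_norm]
  refine le_trans (le_of_eq ?_) (norm_add_le _ _)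
  have hw1 : wave 1 h (pairHalf (γ 1)) =
      angle h k - Real.arccos (1 / ‖k‖) + ‖k‖ * Real.sin (Real.arccos (1 / ‖k‖)) := by
    rw [hk]; unfold wave; ring
  have hw0 : wave 1 h x =
      Real.arccos (1 / ‖h‖) + ‖x‖ * Real.sin (Real.arccos (1 / ‖x‖)) := by
    rw [← hG]; unfold wave; ring
  simp only [X, Φ]
  rw [← WithLp.toLp_sub, Prod.mk_sub_mk, ← WithLp.toLp_add, Prod.mk_add_mk, ← smul_sub, ← smul_add,
    ← mul_sub, ← mul_add, ← Real.sqrt_sq (norm_nonneg (WithLp.toLp 2 (_, _))),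
    norm_toLp_sqrt_two_sq, ← hx, hw1, hw0, hdist, sub_add_sub_cancel]
  congr 3
  ring

theorem mul_cos_arccos_one_div {r : ℝ} (hr : 1 ≤ r) : r * Real.cos (Real.arccos (1 / r)) = 1 := by
  have h0 : 0 ≤ 1 / r := by positivity
  rw [Real.cos_arccos (by linarith) (div_le_self zero_le_one hr)]
  field_simp

theorem mul_sin_arccos_one_div {r : ℝ} (hr : 1 ≤ r) :
    r * Real.sin (Real.arccos (1 / r)) = √(r ^ 2 - 1) := by
  have hr0 : 0 ≤ r := by linarith
  rw [Real.sin_arccos, ← Real.sqrt_sq hr0, ← Real.sqrt_mul (sq_nonneg r), Real.sqrt_sq hr0]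
  congr 1
  field_simp

theorem angle_eq_arccos_of_inner_eq_one {h u : E} (hu : ‖u‖ = 1) (hi : ⟪h, u⟫ = 1) :
    angle h u = Real.arccos (1 / ‖h‖) := by
  rw [angle, hu, hi, mul_one]

theorem exists_orthonormal_frame {h k : E} (hh : h ≠ 0) (hk : k ≠ 0)
    (hs : 0 < Real.sin (angle h k)) :
    ∃ e f : E, ‖e‖ = 1 ∧ ‖f‖ = 1 ∧ ⟪e, f⟫ = 0 ∧ h = ‖h‖ • e ∧
      k = ‖k‖ • (Real.cos (angle h k) • e + Real.sin (angle h k) • f) := by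
  have hh' := norm_ne_zero_iff.2 hh
  have hk' := norm_ne_zero_iff.2 hk
  set c := Real.cos (angle h k) with hc
  set s := Real.sin (angle h k) with hsdef
  have hsc : s ^ 2 + c ^ 2 = 1 := Real.sin_sq_add_cos_sq _
  set e : E := ‖h‖⁻¹ • h with he
  set g : E := ‖k‖⁻¹ • k with hg
  have hen : ‖e‖ = 1 := by rw [he, norm_smul, norm_inv, norm_norm, inv_mul_cancel₀ hh']
  have hgn : ‖g‖ = 1 := by rw [hg, norm_smul, norm_inv, norm_norm, inv_mul_cancel₀ hk']
  have hee : ⟪e, e⟫ = 1 := by rw [real_inner_self_eq_norm_sq, hen, one_pow]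
  have hgg : ⟪g, g⟫ = 1 := by rw [real_inner_self_eq_norm_sq, hgn, one_pow]
  have heg : ⟪e, g⟫ = c := by
    rw [he, hg, real_inner_smul_left, real_inner_smul_right, hc, cos_angle]
    field_simp
  have hge : ⟪g, e⟫ = c := by rw [real_inner_comm, heg]
  clear_value e g
  refine ⟨e, s⁻¹ • (g - c • e), hen, ?_, ?_, ?_, ?_⟩
  · rw [← sq_eq_sq₀ (norm_nonneg _) zero_le_one, norm_smul, mul_pow,
      ← real_inner_self_eq_norm_sq (g - c • e), inner_sub_left, inner_sub_right, inner_sub_right,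
      real_inner_smul_left, real_inner_smul_left, real_inner_smul_right, real_inner_smul_right,
      heg, hge, hee, hgg, Real.norm_eq_abs, sq_abs]
    field_simp
    linear_combination -hsc
  · rw [real_inner_smul_right, inner_sub_right, real_inner_smul_right, hee, heg]
    ring
  · rw [he, smul_inv_smul₀ hh']
  · rw [smul_inv_smul₀ hs.ne', add_sub_cancel, hg, smul_inv_smul₀ hk']

/-- The point at signed distance `s` from the point of angle `ψ`, on the tangent line there to the
unit circle of the plane spanned by the orthonormal pair `e`, `f`. -/
noncomputable def tangentPoint (e f : E) (ψ s : ℝ) : E :=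
  (Real.cos ψ - s * Real.sin ψ) • e + (Real.sin ψ + s * Real.cos ψ) • f

section Frame

variable {e f : E} (he : ‖e‖ = 1) (hf : ‖f‖ = 1) (hef : ⟪e, f⟫ = 0)
include he hf hef

theorem inner_smul_add_smul (x y x' y' : ℝ) :
    ⟪x • e + y • f, x' • e + y' • f⟫ = x * x' + y * y' := by
  have hfe : ⟪f, e⟫ = 0 := by rw [real_inner_comm, hef]
  rw [inner_add_left, inner_add_right, inner_add_right]
  simp only [real_inner_smul_left, real_inner_smul_right, real_inner_self_eq_norm_sq, he, hf, hef,
    hfe]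
  ring

theorem norm_smul_add_smul_sq (x y : ℝ) : ‖x • e + y • f‖ ^ 2 = x ^ 2 + y ^ 2 := by
  rw [← real_inner_self_eq_norm_sq, inner_smul_add_smul he hf hef]
  ring

theorem norm_tangentPoint_sq (ψ s : ℝ) : ‖tangentPoint e f ψ s‖ ^ 2 = 1 + s ^ 2 := by
  rw [tangentPoint, norm_smul_add_smul_sq he hf hef]
  linear_combination (1 + s ^ 2) * Real.sin_sq_add_cos_sq ψ

theorem inner_tangentPoint_zero (ψ χ s : ℝ) :
    ⟪tangentPoint e f ψ s, tangentPoint e f χ 0⟫ = Real.cos (ψ - χ) - s * Real.sin (ψ - χ) := by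
  rw [tangentPoint, tangentPoint, inner_smul_add_smul he hf hef, Real.cos_sub, Real.sin_sub]
  ring

theorem norm_tangentPoint_zero (ψ : ℝ) : ‖tangentPoint e f ψ 0‖ = 1 := by
  rw [← sq_eq_sq₀ (norm_nonneg _) zero_le_one, norm_tangentPoint_sq he hf hef]
  ring

theorem dist_tangentPoint_right (ψ s t : ℝ) :
    dist (tangentPoint e f ψ s) (tangentPoint e f ψ t) = |s - t| := by
  rw [dist_eq_norm, ← sq_eq_sq₀ (norm_nonneg _) (abs_nonneg _), sq_abs]
  have : tangentPoint e f ψ s - tangentPoint e f ψ t =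
      (-(s - t) * Real.sin ψ) • e + ((s - t) * Real.cos ψ) • f := by
    unfold tangentPoint; module
  rw [this, norm_smul_add_smul_sq he hf hef]
  linear_combination (s - t) ^ 2 * Real.sin_sq_add_cos_sq ψ

theorem dist_tangentPoint_left_le (ψ χ : ℝ) :
    dist (tangentPoint e f ψ 0) (tangentPoint e f χ 0) ≤ |ψ - χ| := by
  rw [dist_eq_norm, ← sq_le_sq₀ (norm_nonneg _) (abs_nonneg _), sq_abs, norm_sub_sq_real,
    inner_tangentPoint_zero he hf hef, norm_tangentPoint_zero he hf hef,
    norm_tangentPoint_zero he hf hef]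
  linarith [Real.one_sub_sq_div_two_le_cos (x := ψ - χ)]

/-- The taut path that follows a tangent line up to the angle `α`, the unit circle up to the
angle `α + β`, and then again a tangent line. -/
theorem dist_taut_le (α : ℝ) {β : ℝ} (hβ : 0 ≤ β) (s t : ℝ) :
    dist (tangentPoint e f (α + max 0 (min s β)) (s - max 0 (min s β)))
      (tangentPoint e f (α + max 0 (min t β)) (t - max 0 (min t β))) ≤ |s - t| := by
  wlog hst : s ≤ t generalizing s t
  · rw [dist_comm, abs_sub_comm]
    exact this t s (le_of_not_ge hst)
  set q : ℝ → E := fun s => tangentPoint e f (α + max 0 (min s β)) (s - max 0 (min s β)) with hq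
  change dist (q s) (q t) ≤ _
  have q1 : ∀ x ≤ 0, q x = tangentPoint e f α x := fun x hx => by
    simp [hq, max_eq_left ((min_le_left x β).trans hx)]
  have q2 : ∀ x, 0 ≤ x → x ≤ β → q x = tangentPoint e f (α + x) 0 := fun x h0 h1 => by
    simp [hq, min_eq_left h1, max_eq_right h0]
  have q3 : ∀ x, β ≤ x → q x = tangentPoint e f (α + β) (x - β) := fun x hx => by
    simp [hq, min_eq_right hx, max_eq_right hβ]
  have d1 : ∀ x y, x ≤ y → y ≤ 0 → dist (q x) (q y) ≤ y - x := fun x y hxy hy => by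
    rw [q1 x (hxy.trans hy), q1 y hy, dist_tangentPoint_right he hf hef, abs_sub_comm,
      abs_of_nonneg (sub_nonneg.2 hxy)]
  have d2 : ∀ x y, x ≤ y → 0 ≤ x → y ≤ β → dist (q x) (q y) ≤ y - x := fun x y hxy hx hy => by
    rw [q2 x hx (hxy.trans hy), q2 y (hx.trans hxy) hy]
    refine (dist_tangentPoint_left_le he hf hef _ _).trans (le_of_eq ?_)
    rw [add_sub_add_left_eq_sub, abs_sub_comm, abs_of_nonneg (sub_nonneg.2 hxy)]
  have d3 : ∀ x y, x ≤ y → β ≤ x → dist (q x) (q y) ≤ y - x := fun x y hxy hx => by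
    rw [q3 x hx, q3 y (hx.trans hxy), dist_tangentPoint_right he hf hef, sub_sub_sub_cancel_right,
      abs_sub_comm, abs_of_nonneg (sub_nonneg.2 hxy)]
  have d23 : ∀ x y, x ≤ y → 0 ≤ x → dist (q x) (q y) ≤ y - x := fun x y hxy hx => by
    rcases le_total y β with hy | hy
    · exact d2 x y hxy hx hy
    rcases le_total β x with hx' | hx'
    · exact d3 x y hxy hx'
    · linarith [dist_triangle (q x) (q β) (q y), d2 x β hx' hx le_rfl, d3 β y hy le_rfl]
  rw [abs_sub_comm, abs_of_nonneg (sub_nonneg.2 hst)]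
  rcases le_total t 0 with ht | ht
  · exact d1 s t hst ht
  rcases le_total 0 s with hs | hs
  · exact d23 s t hst hs
  · linarith [dist_triangle (q s) (q 0) (q t), d1 s 0 hs le_rfl, d23 0 t ht le_rfl]

end Frame

theorem one_lt_convex_comb {x y t : ℝ} (hx : 1 < x) (hy : 1 < y) (ht : t ∈ Icc (0 : ℝ) 1) :
    1 < (1 - t) * x + t * y :=
  convex_Ioi (1 : ℝ) hx hy (sub_nonneg.2 ht.2) ht.1 (sub_add_cancel 1 t)

theorem arccos_add_arccos_le_angle {h k : E} (hh : 1 < ‖h‖) (hk : 1 < ‖k‖)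
    (hs : 0 < Real.sin (angle h k)) {t : ℝ} (ht : t ∈ Icc (0 : ℝ) 1)
    (hle : ‖(1 - t) • h + t • k‖ ≤ 1) :
    Real.arccos (1 / ‖h‖) + Real.arccos (1 / ‖k‖) ≤ angle h k := by
  have hh0 : h ≠ 0 := norm_pos_iff.1 (by linarith)
  have hk0 : k ≠ 0 := norm_pos_iff.1 (by linarith)
  obtain ⟨e, f, he, hf, hef, hhe, hkef⟩ := exists_orthonormal_frame hh0 hk0 hs
  by_contra! hlt
  have hpos : ∀ r : ℝ, 1 < r → 0 < Real.arccos (1 / r) := fun r hr =>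
    Real.arccos_pos.2 (by rw [div_lt_one (by linarith)]; exact hr)
  have ha := hpos _ hh
  have hb := hpos _ hk
  have hca := mul_cos_arccos_one_div hh.le
  have hcb := mul_cos_arccos_one_div hk.le
  have hpa := Real.arccos_le_pi (1 / ‖h‖)
  have hpb := Real.arccos_le_pi (1 / ‖k‖)
  have hθ0 := angle_nonneg h k
  generalize Real.arccos (1 / ‖h‖) = a at *
  generalize Real.arccos (1 / ‖k‖) = b at *
  generalize angle h k = θ at *
  have hab : 0 < a + b := by linarith
  obtain ⟨φ, hφ0, hφa, hφθ, hφb⟩ : ∃ φ, 0 ≤ φ ∧ φ < a ∧ 0 ≤ θ - φ ∧ θ - φ < b := by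
    have e1 : θ - θ * a / (a + b) = θ * b / (a + b) := by field_simp; ring
    refine ⟨θ * a / (a + b), by positivity, ?_, ?_, ?_⟩
    · rw [div_lt_iff₀ hab]; nlinarith
    · rw [e1]; positivity
    · rw [e1, div_lt_iff₀ hab]; nlinarith
  have h1 := Real.cos_lt_cos_of_nonneg_of_le_pi hφ0 hpa hφa
  have h2 := Real.cos_lt_cos_of_nonneg_of_le_pi hφθ hpb hφb
  have i1 : ⟪h, tangentPoint e f φ 0⟫ = ‖h‖ * Real.cos φ := by
    have : h = ‖h‖ • tangentPoint e f 0 0 := by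
      simpa [tangentPoint] using hhe
    nth_rw 1 [this]
    rw [real_inner_smul_left, inner_tangentPoint_zero he hf hef, zero_sub, Real.cos_neg, zero_mul,
      sub_zero]
  have i2 : ⟪k, tangentPoint e f φ 0⟫ = ‖k‖ * Real.cos (θ - φ) := by
    have : k = ‖k‖ • tangentPoint e f θ 0 := by
      simpa [tangentPoint] using hkef
    nth_rw 1 [this]
    rw [real_inner_smul_left, inner_tangentPoint_zero he hf hef, zero_mul, sub_zero]
  have hcs := real_inner_le_norm ((1 - t) • h + t • k) (tangentPoint e f φ 0)
  rw [norm_tangentPoint_zero he hf hef, mul_one, inner_add_left, real_inner_smul_left,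
    real_inner_smul_left, i1, i2] at hcs
  have h1' : 1 < ‖h‖ * Real.cos φ := by nlinarith
  have h2' : 1 < ‖k‖ * Real.cos (θ - φ) := by nlinarith
  linarith [one_lt_convex_comb h1' h2' ht]

/-- A unit vector whose angles with `h` and `k` add up to the angle of `h` and `k` lies in their
plane. -/
theorem eq_tangentPoint_of_angle_eq {h k e f x : E} (he : ‖e‖ = 1) (hf : ‖f‖ = 1)
    (hef : ⟪e, f⟫ = 0) (hh0 : h ≠ 0) (hk0 : k ≠ 0) (hhe : h = ‖h‖ • e)
    (hkef : k = ‖k‖ • (Real.cos (angle h k) • e + Real.sin (angle h k) • f))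
    (hs : 0 < Real.sin (angle h k)) (hx : ‖x‖ = 1) {φ : ℝ} (hhx : angle h x = φ)
    (hxk : angle x k = angle h k - φ) : x = tangentPoint e f φ 0 := by
  have hh' := norm_ne_zero_iff.2 hh0
  have hk' := norm_ne_zero_iff.2 hk0
  have i1 : ⟪e, x⟫ = Real.cos φ := by
    have := cos_angle_mul_norm_mul_norm h x
    rw [hhx, hx, mul_one] at this
    nth_rw 2 [hhe] at this
    rw [real_inner_smul_left, mul_comm] at this
    exact (mul_left_cancel₀ hh' this).symm
  have i2 : Real.sin (angle h k) * ⟪f, x⟫ =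
      Real.cos (angle h k - φ) - Real.cos (angle h k) * Real.cos φ := by
    have := cos_angle_mul_norm_mul_norm k x
    rw [angle_comm, hxk, hx, mul_one, mul_comm] at this
    generalize angle h k = θ at *
    nth_rw 2 [hkef] at this
    rw [real_inner_smul_left] at this
    have := mul_left_cancel₀ hk' this
    rw [inner_add_left, real_inner_smul_left, real_inner_smul_left, i1] at this
    linarith
  have i3 : ⟪f, x⟫ = Real.sin φ := by
    rw [Real.cos_sub, add_sub_cancel_left] at i2
    exact mul_left_cancel₀ hs.ne' i2
  rw [← inner_eq_one_iff_of_norm_eq_one (𝕜 := ℝ) hx (norm_tangentPoint_zero he hf hef φ),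
    real_inner_comm, tangentPoint, inner_add_left, real_inner_smul_left, real_inner_smul_left, i1,
    i3]
  linear_combination Real.sin_sq_add_cos_sq φ

theorem linearIndependent_of_segment {h k : E} (hh : 1 < ‖h‖) (hk : 1 < ‖k‖)
    (hne : ∀ t ∈ Icc (0 : ℝ) 1, (1 - t) • h + t • k ≠ 0)
    (hle : ∃ t ∈ Icc (0 : ℝ) 1, ‖(1 - t) • h + t • k‖ ≤ 1) :
    LinearIndependent ℝ ![h, k] := by
  rw [LinearIndependent.pair_iff' (norm_pos_iff.1 (by linarith))]
  rintro c rfl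
  have hcomb : ∀ t : ℝ, (1 - t) • h + t • c • h = ((1 - t) + t * c) • h := fun t => by module
  rcases lt_or_ge c 0 with hc | hc
  · refine hne (1 / (1 - c)) ⟨by apply div_nonneg <;> linarith, ?_⟩ ?_
    · rw [div_le_one (by linarith)]; linarith
    · rw [hcomb]
      have : 1 - 1 / (1 - c) + 1 / (1 - c) * c = 0 := by
        have : 1 - c ≠ 0 := by linarith
        field_simp
        ring
      rw [this, zero_smul]
  · obtain ⟨t, ht, hle⟩ := hle
    rw [norm_smul, Real.norm_of_nonneg hc] at hk
    rw [hcomb, norm_smul, Real.norm_of_nonneg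
      (add_nonneg (by linarith [ht.2]) (mul_nonneg ht.1 hc))] at hle
    linarith [one_lt_convex_comb hh hk ht]

theorem sin_angle_pos_of_linearIndependent {h k : E} (hli : LinearIndependent ℝ ![h, k]) :
    0 < Real.sin (angle h k) := by
  have hh : h ≠ 0 := by simpa using hli.ne_zero 0
  rw [LinearIndependent.pair_iff' hh] at hli
  refine lt_of_le_of_ne (Real.sin_nonneg_of_nonneg_of_le_pi (angle_nonneg h k) (angle_le_pi h k))
    fun h0 => ?_
  rw [eq_comm, sin_eq_zero_iff_angle_eq_zero_or_angle_eq_pi] at h0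
  rcases h0 with h0 | h0
  · obtain ⟨-, r, -, hr⟩ := angle_eq_zero_iff.1 h0
    exact hli r hr.symm
  · obtain ⟨-, r, -, hr⟩ := angle_eq_pi_iff.1 h0
    exact hli r hr.symm

theorem eVariationOn_le_of_dist_le {W : Type*} [PseudoMetricSpace W] {γ : ℝ → W} {C : ℝ}
    (h : ∀ s t, dist (γ s) (γ t) ≤ C * dist s t) :
    eVariationOn γ (Icc 0 1) ≤ ENNReal.ofReal C := by
  have hl : LipschitzOnWith C.toNNReal γ univ :=
    (LipschitzWith.of_dist_le' h).lipschitzOnWith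
  refine (hl.comp_eVariationOn_le (g := id) (mapsTo_univ _ _)).trans ?_
  have := (monotone_id.monotoneOn (Icc (0 : ℝ) 1)).eVariationOn_eq (left_mem_Icc.2 zero_le_one)
    (right_mem_Icc.2 zero_le_one)
  rw [inter_self] at this
  refine (mul_le_mul_right this.le _).trans (le_of_eq ?_)
  simp [ENNReal.ofReal]

theorem eq_tangentPoint_neg {h e f : E} (hh : 1 ≤ ‖h‖) (hhe : h = ‖h‖ • e) :
    h = tangentPoint e f (Real.arccos (1 / ‖h‖))
      (-(‖h‖ * Real.sin (Real.arccos (1 / ‖h‖)))) := by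
  have hc := mul_cos_arccos_one_div hh
  generalize Real.arccos (1 / ‖h‖) = a at *
  have h1 : Real.cos a - -(‖h‖ * Real.sin a) * Real.sin a = ‖h‖ := by
    linear_combination -Real.cos a * hc + ‖h‖ * Real.sin_sq_add_cos_sq a
  have h2 : Real.sin a + -(‖h‖ * Real.sin a) * Real.cos a = 0 := by
    linear_combination -Real.sin a * hc
  rw [tangentPoint, h1, h2, zero_smul, add_zero, ← hhe]

theorem eq_tangentPoint_sub {k e f : E} {θ : ℝ} (hk : 1 ≤ ‖k‖)
    (hkef : k = ‖k‖ • (Real.cos θ • e + Real.sin θ • f)) :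
    k = tangentPoint e f (θ - Real.arccos (1 / ‖k‖))
      (‖k‖ * Real.sin (Real.arccos (1 / ‖k‖))) := by
  have hc := mul_cos_arccos_one_div hk
  generalize Real.arccos (1 / ‖k‖) = b at *
  have h1 : Real.cos (θ - b) - ‖k‖ * Real.sin b * Real.sin (θ - b) = ‖k‖ * Real.cos θ := by
    nth_rw 3 [← sub_add_cancel θ b]
    rw [Real.cos_add]
    linear_combination -Real.cos (θ - b) * hc
  have h2 : Real.sin (θ - b) + ‖k‖ * Real.sin b * Real.cos (θ - b) = ‖k‖ * Real.sin θ := by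
    nth_rw 3 [← sub_add_cancel θ b]
    rw [Real.sin_add]
    linear_combination -Real.sin (θ - b) * hc
  rw [tangentPoint, h1, h2, mul_smul, mul_smul, ← smul_add, ← hkef]

theorem exists_unique_closest_tangent_pair {h k : E} (hh : 1 < ‖h‖) (hk : 1 < ‖k‖)
    (hs : 0 < Real.sin (angle h k))
    (hang : Real.arccos (1 / ‖h‖) + Real.arccos (1 / ‖k‖) ≤ angle h k) :
    ∃ u v : E, ‖u‖ = 1 ∧ ‖v‖ = 1 ∧ ⟪h, u⟫ = 1 ∧ ⟪k, v⟫ = 1 ∧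
      (∀ u' v' : E, ‖u'‖ = 1 → ‖v'‖ = 1 → ⟪h, u'⟫ = 1 → ⟪k, v'⟫ = 1 → ‖u - v‖ ≤ ‖u' - v'‖) ∧
      (∀ u' v' : E, ‖u'‖ = 1 → ‖v'‖ = 1 → ⟪h, u'⟫ = 1 → ⟪k, v'⟫ = 1 → ‖u' - v'‖ ≤ ‖u - v‖ →
        u' = u ∧ v' = v) ∧
      Real.arccos ⟪u, v⟫ = angle h k - Real.arccos (1 / ‖h‖) - Real.arccos (1 / ‖k‖) := by
  have hh0 : h ≠ 0 := norm_pos_iff.1 (by linarith)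
  have hk0 : k ≠ 0 := norm_pos_iff.1 (by linarith)
  obtain ⟨e, f, he, hf, hef, hhe, hkef⟩ := exists_orthonormal_frame hh0 hk0 hs
  have hht := eq_tangentPoint_neg (f := f) hh.le hhe
  have hkt := eq_tangentPoint_sub hk.le hkef
  have ha := Real.arccos_nonneg (1 / ‖h‖)
  have hb := Real.arccos_nonneg (1 / ‖k‖)
  have hθ := angle_le_pi h k
  have hangu : ∀ u' : E, ‖u'‖ = 1 → ⟪h, u'⟫ = 1 → angle h u' = Real.arccos (1 / ‖h‖) :=
    fun u' => angle_eq_arccos_of_inner_eq_one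
  have hangv : ∀ v' : E, ‖v'‖ = 1 → ⟪k, v'⟫ = 1 → angle v' k = Real.arccos (1 / ‖k‖) :=
    fun v' h1 h2 => by rw [angle_comm, angle_eq_arccos_of_inner_eq_one h1 h2]
  set a := Real.arccos (1 / ‖h‖)
  set b := Real.arccos (1 / ‖k‖)
  set u := tangentPoint e f a 0 with hu
  set v := tangentPoint e f (angle h k - b) 0 with hv
  have hun : ‖u‖ = 1 := norm_tangentPoint_zero he hf hef _
  have hvn : ‖v‖ = 1 := norm_tangentPoint_zero he hf hef _
  have hhu : ⟪h, u⟫ = 1 := by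
    nth_rw 1 [hht]
    rw [hu, inner_tangentPoint_zero he hf hef]; simp
  have hkv : ⟪k, v⟫ = 1 := by
    nth_rw 1 [hkt]
    rw [hv, inner_tangentPoint_zero he hf hef]; simp
  have huv : ⟪u, v⟫ = Real.cos (angle h k - a - b) := by
    rw [hu, hv, inner_tangentPoint_zero he hf hef, zero_mul, sub_zero, ← Real.cos_neg]
    congr 1; ring
  have hnorm : ∀ x y : E, ‖x‖ = 1 → ‖y‖ = 1 → ‖x - y‖ ^ 2 = 2 - 2 * Real.cos (angle x y) := by
    intro x y hx hy
    rw [norm_sub_sq_real, cos_angle, hx, hy]; ring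
  have hauv : angle u v = angle h k - a - b := by
    rw [angle, hun, hvn, huv, mul_one, div_one, Real.arccos_cos (by linarith) (by linarith)]
  have hchain : ∀ u' v' : E, ‖u'‖ = 1 → ‖v'‖ = 1 → ⟪h, u'⟫ = 1 → ⟪k, v'⟫ = 1 →
      angle h k - a - b ≤ angle u' v' := by
    intro u' v' hu' hv' hhu' hkv'
    have := angle_le_angle_add_angle h u' k
    have := angle_le_angle_add_angle u' v' k
    linarith [hangu u' hu' hhu', hangv v' hv' hkv']
  refine ⟨u, v, hun, hvn, hhu, hkv, ?_, ?_, ?_⟩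
  · intro u' v' hu' hv' hhu' hkv'
    have hle := hchain u' v' hu' hv' hhu' hkv'
    rw [← sq_le_sq₀ (norm_nonneg _) (norm_nonneg _), hnorm u v hun hvn, hnorm u' v' hu' hv', hauv]
    linarith [Real.cos_le_cos_of_nonneg_of_le_pi (by linarith) (angle_le_pi u' v') hle]
  · intro u' v' hu' hv' hhu' hkv' hle
    rw [← sq_le_sq₀ (norm_nonneg _) (norm_nonneg _), hnorm u v hun hvn, hnorm u' v' hu' hv',
      hauv] at hle
    have hle' : angle u' v' ≤ angle h k - a - b := by
      by_contra! hlt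
      linarith [Real.cos_lt_cos_of_nonneg_of_le_pi (by linarith) (angle_le_pi u' v') hlt]
    have t1 := angle_le_angle_add_angle h u' k
    have t2 := angle_le_angle_add_angle u' v' k
    have t3 := angle_le_angle_add_angle h v' k
    have t4 := angle_le_angle_add_angle h u' v'
    have e1 := hangu u' hu' hhu'
    have e2 := hangv v' hv' hkv'
    exact ⟨eq_tangentPoint_of_angle_eq he hf hef hh0 hk0 hhe hkef hs hu' e1 (by linarith),
      eq_tangentPoint_of_angle_eq he hf hef hh0 hk0 hhe hkef hs hv' (by linarith) (by linarith)⟩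
  · rw [huv, Real.arccos_cos (by linarith) (by linarith)]

/-- The taut path realises the lower bound `ofReal_sqrt_le_eVariationOn`. -/
theorem exists_path_eVariationOn_le {h k : E} (hh : 1 < ‖h‖) (hk : 1 < ‖k‖)
    (hs : 0 < Real.sin (angle h k))
    (hang : Real.arccos (1 / ‖h‖) + Real.arccos (1 / ‖k‖) ≤ angle h k) (A B : E) :
    ∃ γ : ℝ → WithLp 2 (E × E), Continuous γ ∧ (∀ t, 1 ≤ ‖pairHalf (γ t)‖) ∧
      γ 0 = WithLp.toLp 2 (A - h, A + h) ∧ γ 1 = WithLp.toLp 2 (B - k, B + k) ∧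
      eVariationOn γ (Icc 0 1) ≤ ENNReal.ofReal (√(2 * (‖A - B‖ ^ 2 +
        (angle h k - Real.arccos (1 / ‖h‖) - Real.arccos (1 / ‖k‖) +
          ‖h‖ * Real.sin (Real.arccos (1 / ‖h‖)) +
          ‖k‖ * Real.sin (Real.arccos (1 / ‖k‖))) ^ 2))) := by
  have hh0 : h ≠ 0 := norm_pos_iff.1 (by linarith)
  have hk0 : k ≠ 0 := norm_pos_iff.1 (by linarith)
  obtain ⟨e, f, he, hf, hef, hhe, hkef⟩ := exists_orthonormal_frame hh0 hk0 hs
  have hht := eq_tangentPoint_neg (f := f) hh.le hhe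
  have hkt := eq_tangentPoint_sub hk.le hkef
  have hS₀ : 0 ≤ ‖h‖ * Real.sin (Real.arccos (1 / ‖h‖)) := by
    rw [mul_sin_arccos_one_div hh.le]; positivity
  have hS₁ : 0 ≤ ‖k‖ * Real.sin (Real.arccos (1 / ‖k‖)) := by
    rw [mul_sin_arccos_one_div hk.le]; positivity
  generalize ‖h‖ * Real.sin (Real.arccos (1 / ‖h‖)) = S₀ at *
  generalize ‖k‖ * Real.sin (Real.arccos (1 / ‖k‖)) = S₁ at *
  generalize Real.arccos (1 / ‖h‖) = a at *
  generalize Real.arccos (1 / ‖k‖) = b at *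
  obtain ⟨β, hβ⟩ : ∃ β, β = angle h k - a - b := ⟨_, rfl⟩
  rw [← hβ]
  have hβ0 : 0 ≤ β := by linarith
  set d := β + S₀ + S₁ with hd
  let q : ℝ → E := fun σ => tangentPoint e f (a + max 0 (min σ β)) (σ - max 0 (min σ β))
  have hq : ∀ s t, dist (q s) (q t) ≤ |s - t| := dist_taut_le he hf hef a hβ0
  let m : ℝ → E := fun t => A + t • (B - A)
  let r : ℝ → E := fun t => q (-S₀ + t * d)
  let γ : ℝ → WithLp 2 (E × E) := fun t => WithLp.toLp 2 (m t - r t, m t + r t)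
  have hmid : ∀ t, pairMid (γ t) = m t := fun t => by
    simp only [pairMid, γ, WithLp.toLp_fst, WithLp.toLp_snd]; module
  have hhalf : ∀ t, pairHalf (γ t) = r t := fun t => by
    simp only [pairHalf, γ, WithLp.toLp_fst, WithLp.toLp_snd]; module
  have hlip : ∀ s t, dist (γ s) (γ t) ≤ √(2 * (‖A - B‖ ^ 2 + d ^ 2)) * dist s t := by
    intro s t
    have h1 : m s - m t = (s - t) • (B - A) := by simp only [m]; module
    have h2 : ‖r s - r t‖ ≤ |(s - t) * d| := by
      rw [← dist_eq_norm]
      refine (hq _ _).trans (le_of_eq ?_)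
      congr 1; ring
    have h3 : ‖r s - r t‖ ^ 2 ≤ ((s - t) * d) ^ 2 := by
      rw [← sq_abs ((s - t) * d)]
      exact pow_le_pow_left₀ (norm_nonneg _) h2 2
    rw [← sq_le_sq₀ dist_nonneg (by positivity), dist_sq_eq_pairMid_pairHalf, hmid, hmid, hhalf,
      hhalf, mul_pow, Real.sq_sqrt (by positivity), h1, norm_smul, mul_pow, Real.norm_eq_abs,
      Real.dist_eq, norm_sub_rev B A, sq_abs]
    linarith
  refine ⟨γ, (LipschitzWith.of_dist_le' hlip).continuous, fun t => ?_, ?_, ?_,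
    eVariationOn_le_of_dist_le hlip⟩
  · rw [hhalf, ← one_le_sq_iff₀ (norm_nonneg _)]
    simp only [r, q]
    rw [norm_tangentPoint_sq he hf hef]
    linarith [sq_nonneg (-S₀ + t * d - max 0 (min (-S₀ + t * d) β))]
  · have hm : m 0 = A := by simp [m]
    have hr : r 0 = h := by
      have : min (-S₀ + 0 * d) β ≤ 0 := (min_le_left _ _).trans (by linarith)
      simp only [r, q]
      rw [max_eq_left this, zero_mul, add_zero, add_zero, sub_zero, ← hht]
    simp only [γ, hm, hr]
  · have hm : m 1 = B := by simp [m]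
    have hr : r 1 = k := by
      have e1 : -S₀ + 1 * d = β + S₁ := by rw [hd]; ring
      simp only [r, q]
      rw [e1, min_eq_right (by linarith : β ≤ β + S₁), max_eq_right hβ0, add_sub_cancel_left]
      refine Eq.trans ?_ hkt.symm
      congr 1
      rw [hβ]; ring
    simp only [γ, hm, hr]

end Wave

end PathLength

/-- Theorem (case `0 < δ ≤ 2`, interior points): `h` and `k` are linearly independent;
for the unique minimizing pair `(u,v)` of unit vectors with `h·u = 1 = k·v`, and `β` the
angle between `u` and `v`, the infimum of lengths of paths in `F₀(ℝⁿ,2)` from `P = (a,a')`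
to `Q = (b,b')` equals `√(2(‖A−B‖² + (β+S₀+S₁)²))`, and it is attained. -/
theorem stmt19 {n : ℕ} (hn : 2 ≤ n) (a a' b b' h k A B : EuclideanSpace ℝ (Fin n))
    (hP : toL2 a a' ∈ F0 n) (hQ : toL2 b b' ∈ F0 n)
    (hdefh : h = (2:ℝ)⁻¹ • (a' - a)) (hdefk : k = (2:ℝ)⁻¹ • (b' - b))
    (hdefA : A = (2:ℝ)⁻¹ • (a + a')) (hdefB : B = (2:ℝ)⁻¹ • (b + b'))
    (hh : 1 < ‖h‖) (hk : 1 < ‖k‖)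
    (hδpos : 0 < sInf ((fun t : ℝ =>
      ‖(t • b + (1 - t) • a) - (t • b' + (1 - t) • a')‖) '' Set.Icc 0 1))
    (hδle : sInf ((fun t : ℝ =>
      ‖(t • b + (1 - t) • a) - (t • b' + (1 - t) • a')‖) '' Set.Icc 0 1) ≤ 2) :
    LinearIndependent ℝ ![h, k] ∧
    ∃ u v : EuclideanSpace ℝ (Fin n), ‖u‖ = 1 ∧ ‖v‖ = 1 ∧ ⟪h, u⟫ = 1 ∧ ⟪k, v⟫ = 1 ∧
      (∀ u' v' : EuclideanSpace ℝ (Fin n),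
        ‖u'‖ = 1 → ‖v'‖ = 1 → ⟪h, u'⟫ = 1 → ⟪k, v'⟫ = 1 → ‖u - v‖ ≤ ‖u' - v'‖) ∧
      (∀ u' v' : EuclideanSpace ℝ (Fin n),
        (‖u'‖ = 1 ∧ ‖v'‖ = 1 ∧ ⟪h, u'⟫ = 1 ∧ ⟪k, v'⟫ = 1 ∧
          ∀ u'' v'' : EuclideanSpace ℝ (Fin n),
            ‖u''‖ = 1 → ‖v''‖ = 1 → ⟪h, u''⟫ = 1 → ⟪k, v''⟫ = 1 →
              ‖u' - v'‖ ≤ ‖u'' - v''‖) → u' = u ∧ v' = v) ∧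
      IsLeast {L : ℝ≥0∞ |
          ∃ γ : ℝ → WithLp 2 (EuclideanSpace ℝ (Fin n) × EuclideanSpace ℝ (Fin n)),
            ContinuousOn γ (Set.Icc 0 1) ∧ (∀ t ∈ Set.Icc (0:ℝ) 1, γ t ∈ F0 n) ∧
            γ 0 = toL2 a a' ∧ γ 1 = toL2 b b' ∧ L = eVariationOn γ (Set.Icc 0 1)}
        (ENNReal.ofReal (Real.sqrt (2 * (‖A - B‖ ^ 2 +
          (Real.arccos ⟪u, v⟫ + Real.sqrt (‖h‖ ^ 2 - 1)
            + Real.sqrt (‖k‖ ^ 2 - 1)) ^ 2)))) := by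
  have hnorm : ∀ t : ℝ, ‖(t • b + (1 - t) • a) - (t • b' + (1 - t) • a')‖ =
      2 * ‖(1 - t) • h + t • k‖ := by
    intro t
    have : (t • b + (1 - t) • a) - (t • b' + (1 - t) • a') =
        (-2 : ℝ) • ((1 - t) • h + t • k) := by
      rw [hdefh, hdefk]; module
    rw [this, norm_smul]
    norm_num
  simp only [hnorm] at hδpos hδle
  have hne : ∀ t ∈ Set.Icc (0 : ℝ) 1, (1 - t) • h + t • k ≠ 0 := by
    intro t ht h0
    have hbdd : BddBelow ((fun t : ℝ => 2 * ‖(1 - t) • h + t • k‖) '' Set.Icc 0 1) := by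
      refine ⟨0, ?_⟩
      rintro _ ⟨s, -, rfl⟩
      positivity
    have hle := csInf_le hbdd (Set.mem_image_of_mem _ ht)
    rw [h0, norm_zero, mul_zero] at hle
    exact absurd hδpos (not_lt.2 hle)
  have hex : ∃ t ∈ Set.Icc (0 : ℝ) 1, ‖(1 - t) • h + t • k‖ ≤ 1 := by
    obtain ⟨t, ht, hmin⟩ := isCompact_Icc.exists_sInf_image_eq
      (Set.nonempty_Icc.2 (zero_le_one (α := ℝ)))
      (f := fun t : ℝ => 2 * ‖(1 - t) • h + t • k‖) (by fun_prop)
    exact ⟨t, ht, by linarith⟩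
  have hli := linearIndependent_of_segment hh hk hne hex
  have hs := sin_angle_pos_of_linearIndependent hli
  obtain ⟨t, ht, hle⟩ := hex
  have hang := arccos_add_arccos_le_angle hh hk hs ht hle
  obtain ⟨u, v, hu, hv, hhu, hkv, hmin, huniq, huv⟩ :=
    exists_unique_closest_tangent_pair hh hk hs hang
  refine ⟨hli, u, v, hu, hv, hhu, hkv, hmin, fun u' v' ⟨hu', hv', hhu', hkv', hmin'⟩ =>
    huniq u' v' hu' hv' hhu' hkv' (hmin' u v hu hv hhu hkv), ?_⟩
  rw [huv, ← mul_sin_arccos_one_div hh.le, ← mul_sin_arccos_one_div hk.le]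
  have hmem : ∀ p : WithLp 2 (EuclideanSpace ℝ (Fin n) × EuclideanSpace ℝ (Fin n)),
      p ∈ F0 n ↔ 1 ≤ ‖pairHalf p‖ := by
    intro p
    change 2 ≤ ‖p.fst - p.snd‖ ↔ _
    rw [pairHalf, norm_smul, norm_sub_rev, Real.norm_of_nonneg (by norm_num : (0 : ℝ) ≤ 2⁻¹)]
    constructor <;> intro _ <;> linarith
  have hPA : pairMid (toL2 a a') = A := hdefA.symm
  have hQB : pairMid (toL2 b b') = B := hdefB.symm
  have hPh : pairHalf (toL2 a a') = h := hdefh.symm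
  have hQk : pairHalf (toL2 b b') = k := hdefk.symm
  have hlower : ∀ γ : ℝ → WithLp 2 (EuclideanSpace ℝ (Fin n) × EuclideanSpace ℝ (Fin n)),
      ContinuousOn γ (Set.Icc 0 1) → (∀ t ∈ Set.Icc (0 : ℝ) 1, γ t ∈ F0 n) →
      γ 0 = toL2 a a' → γ 1 = toL2 b b' →
      ENNReal.ofReal (√(2 * (‖A - B‖ ^ 2 +
        (InnerProductGeometry.angle h k - Real.arccos (1 / ‖h‖) - Real.arccos (1 / ‖k‖) +
          ‖h‖ * Real.sin (Real.arccos (1 / ‖h‖)) +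
          ‖k‖ * Real.sin (Real.arccos (1 / ‖k‖))) ^ 2))) ≤ eVariationOn γ (Set.Icc 0 1) :=
    fun γ hγ hF h0 h1 => by
      have := ofReal_sqrt_le_eVariationOn hγ (fun t ht => (hmem _).1 (hF t ht))
        (h0 ▸ hPh) (h1 ▸ hQk) hang
      rwa [h0, h1, hPA, hQB] at this
  constructor
  · obtain ⟨γ, hγ, hout, h0, h1, hlen⟩ := exists_path_eVariationOn_le hh hk hs hang A B
    have h0' : γ 0 = toL2 a a' := by
      rw [h0, toL2]
      congr 2 <;> rw [hdefA, hdefh] <;> module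
    have h1' : γ 1 = toL2 b b' := by
      rw [h1, toL2]
      congr 2 <;> rw [hdefB, hdefk] <;> module
    have hF : ∀ t ∈ Set.Icc (0 : ℝ) 1, γ t ∈ F0 n := fun t _ => (hmem _).2 (hout t)
    exact ⟨γ, hγ.continuousOn, hF, h0', h1',
      (hlower γ hγ.continuousOn hF h0' h1').antisymm hlen⟩
  · rintro _ ⟨γ, hγ, hF, h0, h1, rfl⟩
    exact hlower γ hγ hF h0 h1
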